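/- Let ω₁ = Σᵢ dzⁱ∧dz̄ⁱ and ω₂ = Σᵢ λᵢ dzⁱ∧dz̄ⁱ be flat Kähler forms on ℂⁿ with λᵢ > 0. Then there exists a Kähler form ω on ℂⁿ and radii 0 < R₁ < R₂ such that ω = ω₂ on {|z| ≤ R₁} and ω = ω₁ on {|z| ≥ R₂}; moreover ω = ω₁ + ∂∂̄R for a compactly supported function R. -/

import Mathlib

open scoped ComplexOrder

/-- The Wirtinger derivative `∂g/∂z_j = ½(∂g/∂x_j − i ∂g/∂y_j)` of `g : ℂⁿ → ℂ`. -/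
noncomputable def wder (n : ℕ) (j : Fin n) (g : (Fin n → ℂ) → ℂ) (z : Fin n → ℂ) : ℂ :=
  (1 / 2 : ℂ) * (fderiv ℝ g z (Pi.single j 1) - Complex.I * fderiv ℝ g z (Pi.single j Complex.I))

/-- The conjugate Wirtinger derivative `∂g/∂z̄_j = ½(∂g/∂x_j + i ∂g/∂y_j)`. -/
noncomputable def wderBar (n : ℕ) (j : Fin n) (g : (Fin n → ℂ) → ℂ) (z : Fin n → ℂ) : ℂ :=
  (1 / 2 : ℂ) * (fderiv ℝ g z (Pi.single j 1) + Complex.I * fderiv ℝ g z (Pi.single j Complex.I))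

/-- The complex Hessian `(∂²φ/∂z_j∂z̄_k)_{jk}` of a real potential `φ`, i.e. the
coefficient matrix of the (1,1)-form `∂∂̄φ`. -/
noncomputable def cHess (n : ℕ) (φ : (Fin n → ℂ) → ℝ) (z : Fin n → ℂ) :
    Matrix (Fin n) (Fin n) ℂ :=
  Matrix.of fun j k => wder n j (fun w => wderBar n k (fun u => ((φ u : ℝ) : ℂ)) w) z

/-- The quadratic form `Σ cᵢ |zᵢ|²` on `ℂⁿ`. -/
def weightedNormSq {n : ℕ} (c : Fin n → ℝ) (z : Fin n → ℂ) : ℝ :=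
  ∑ i, c i * Complex.normSq (z i)

/-- The real derivative of `weightedNormSq c` at `z`. -/
noncomputable def weightedNormSqDeriv {n : ℕ} (c : Fin n → ℝ) (z : Fin n → ℂ) :
    (Fin n → ℂ) →L[ℝ] ℝ :=
  ∑ i, (2 * c i) • ((z i).re • Complex.reCLM.comp (ContinuousLinearMap.proj i) +
    (z i).im • Complex.imCLM.comp (ContinuousLinearMap.proj i))

lemma hasFDerivAt_weightedNormSq {n : ℕ} (c : Fin n → ℝ) (z : Fin n → ℂ) :
    HasFDerivAt (weightedNormSq c) (weightedNormSqDeriv c z) z := by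
  unfold weightedNormSqDeriv
  have hfun : weightedNormSq c =
      fun w => ∑ i, c i * ((w i).re * (w i).re + (w i).im * (w i).im) := by
    funext w; simp [weightedNormSq, Complex.normSq_apply]
  rw [hfun]
  refine HasFDerivAt.fun_sum fun i _ => ?_
  have hre : HasFDerivAt (fun w : Fin n → ℂ => (w i).re)
      (Complex.reCLM.comp (ContinuousLinearMap.proj (R := ℝ) i)) z :=
    (Complex.reCLM.comp (ContinuousLinearMap.proj (R := ℝ) (φ := fun _ : Fin n => ℂ) i)).hasFDerivAt
  have him : HasFDerivAt (fun w : Fin n → ℂ => (w i).im)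
      (Complex.imCLM.comp (ContinuousLinearMap.proj (R := ℝ) i)) z :=
    (Complex.imCLM.comp (ContinuousLinearMap.proj (R := ℝ) (φ := fun _ : Fin n => ℂ) i)).hasFDerivAt
  refine (((hre.mul hre).add (him.mul him)).const_mul (c i)).congr_fderiv ?_
  ext v
  simp
  ring

lemma contDiff_weightedNormSq {n : ℕ} (c : Fin n → ℝ) :
    ContDiff ℝ (⊤ : ℕ∞) (weightedNormSq c) := by
  have hfun : weightedNormSq c = fun w => ∑ i, c i *
      (Complex.reCLM (w i) * Complex.reCLM (w i) + Complex.imCLM (w i) * Complex.imCLM (w i)) := by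
    funext w; simp [weightedNormSq, Complex.normSq_apply]
  rw [hfun]
  fun_prop

@[simp]
lemma weightedNormSqDeriv_single_one {n : ℕ} (c : Fin n → ℝ) (z : Fin n → ℂ) (j : Fin n) :
    weightedNormSqDeriv c z (Pi.single j 1) = 2 * c j * (z j).re := by
  simp only [weightedNormSqDeriv, sum_apply]
  rw [Finset.sum_eq_single j] <;> simp +contextual [mul_assoc]

@[simp]
lemma weightedNormSqDeriv_single_I {n : ℕ} (c : Fin n → ℝ) (z : Fin n → ℂ) (j : Fin n) :
    weightedNormSqDeriv c z (Pi.single j Complex.I) = 2 * c j * (z j).im := by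
  simp only [weightedNormSqDeriv, sum_apply]
  rw [Finset.sum_eq_single j] <;> simp +contextual [mul_assoc]

lemma HasFDerivAt.wderBar_ofReal {n : ℕ} {f : (Fin n → ℂ) → ℝ} {f' : (Fin n → ℂ) →L[ℝ] ℝ}
    {z : Fin n → ℂ} (hf : HasFDerivAt f f' z) (k : Fin n) :
    wderBar n k (fun w => (f w : ℂ)) z =
      1 / 2 * (f' (Pi.single k 1) + Complex.I * f' (Pi.single k Complex.I)) := by
  have h : HasFDerivAt (fun w => (f w : ℂ)) (Complex.ofRealCLM.comp f') z :=
    Complex.ofRealCLM.hasFDerivAt.comp z hf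
  simp [wderBar, h.fderiv]

lemma HasFDerivAt.wder_coord_mul_ofReal {n : ℕ} {f : (Fin n → ℂ) → ℝ}
    {f' : (Fin n → ℂ) →L[ℝ] ℝ} {z : Fin n → ℂ} (hf : HasFDerivAt f f' z) (j k : Fin n) :
    wder n j (fun w => w k * (f w : ℂ)) z = (if j = k then (f z : ℂ) else 0) +
      z k * (1 / 2 * (f' (Pi.single j 1) - Complex.I * f' (Pi.single j Complex.I))) := by
  have h : HasFDerivAt (fun w => (f w : ℂ)) (Complex.ofRealCLM.comp f') z :=
    Complex.ofRealCLM.hasFDerivAt.comp z hf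
  have hc : HasFDerivAt (fun w : Fin n → ℂ => w k)
      (ContinuousLinearMap.proj (R := ℝ) (φ := fun _ : Fin n => ℂ) k) z :=
    (ContinuousLinearMap.proj (R := ℝ) (φ := fun _ : Fin n => ℂ) k).hasFDerivAt
  have hp : HasFDerivAt (fun w : Fin n → ℂ => w k * (f w : ℂ)) _ z := hc.mul h
  rw [wder, hp.fderiv]
  rcases eq_or_ne j k with rfl | hjk
  · simp
    linear_combination (-(f z : ℂ) / 2) * Complex.I_sq
  · simp [hjk, hjk.symm]
    ring

/-- The complex Hessian of `|z|² + g(|z|²) Σ cᵢ |zᵢ|²`. -/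
lemma cHess_weightedNormSq_cutoff {n : ℕ} (c : Fin n → ℝ) {g : ℝ → ℝ}
    (hg : ContDiff ℝ (⊤ : ℕ∞) g) (z : Fin n → ℂ) (j k : Fin n) :
    cHess n (fun w => weightedNormSq 1 w + g (weightedNormSq 1 w) * weightedNormSq c w) z j k =
      (if j = k then ((1 + deriv g (weightedNormSq 1 z) * weightedNormSq c z +
        g (weightedNormSq 1 z) * c k : ℝ) : ℂ) else 0) +
      z k * (starRingEnd ℂ (z j) * ((deriv (deriv g) (weightedNormSq 1 z) * weightedNormSq c z +
        deriv g (weightedNormSq 1 z) * (c j + c k) : ℝ) : ℂ)) := by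
  have hg₁ : ContDiff ℝ (⊤ : ℕ∞) (deriv g) := (contDiff_infty_iff_deriv.1 hg).2
  have hgd (x : ℝ) : HasDerivAt g (deriv g x) x :=
    (hg.differentiable (by simp) x).hasDerivAt
  have hgd₂ (x : ℝ) : HasDerivAt (deriv g) (deriv (deriv g) x) x :=
    (hg₁.differentiable (by simp) x).hasDerivAt
  have hs (w : Fin n → ℂ) := hasFDerivAt_weightedNormSq 1 w
  have hq (w : Fin n → ℂ) := hasFDerivAt_weightedNormSq c w
  have hbar (w : Fin n → ℂ) : wderBar n k (fun u => ((weightedNormSq 1 u +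
      g (weightedNormSq 1 u) * weightedNormSq c u : ℝ) : ℂ)) w =
      w k * ((1 + deriv g (weightedNormSq 1 w) * weightedNormSq c w +
        g (weightedNormSq 1 w) * c k : ℝ) : ℂ) := by
    refine (((hs w).add (((hgd _).comp_hasFDerivAt w (hs w)).mul
      (hq w))).wderBar_ofReal k).trans ?_
    simp
    linear_combination (1 + deriv g (weightedNormSq 1 w) * weightedNormSq c w +
      g (weightedNormSq 1 w) * c k : ℂ) * Complex.re_add_im (w k)
  simp only [cHess, Matrix.of_apply, hbar]
  refine ((((((hgd₂ _).comp_hasFDerivAt z (hs z)).mul (hq z)).const_add 1).add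
    (((hgd _).comp_hasFDerivAt z (hs z)).mul_const (c k))).wder_coord_mul_ofReal j k).trans ?_
  congr 2
  have hz : starRingEnd ℂ (z j) = (z j).re - (z j).im * Complex.I := by
    apply Complex.ext <;> simp
  rw [hz]
  simp
  ring

/-- Slowly varying cutoffs: the first two logarithmic derivatives can be made uniformly small. -/
lemma exists_slow_cutoff {δ : ℝ} (hδ : 0 < δ) :
    ∃ (g : ℝ → ℝ) (T : ℝ), 0 < T ∧ ContDiff ℝ (⊤ : ℕ∞) g ∧ (∀ s, 0 ≤ g s) ∧ (∀ s, g s ≤ 1) ∧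
      (∀ s, |s| ≤ 1 → g s = 1) ∧ (∀ s, T ≤ s → g s = 0) ∧
      (∀ s, |s * deriv g s| ≤ δ) ∧ ∀ s, |s ^ 2 * deriv (deriv g) s| ≤ δ := by
  set ψ := Real.smoothTransition with hψ
  have hψs : ContDiff ℝ (⊤ : ℕ∞) ψ := Real.smoothTransition.contDiff
  have hψ₁ : ContDiff ℝ (⊤ : ℕ∞) (deriv ψ) := (contDiff_infty_iff_deriv.1 hψs).2
  have hψ₂ : ContDiff ℝ (⊤ : ℕ∞) (deriv (deriv ψ)) := (contDiff_infty_iff_deriv.1 hψ₁).2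
  have hsupp : HasCompactSupport (deriv ψ) := by
    refine HasCompactSupport.intro (isCompact_Icc (a := (0 : ℝ)) (b := 1)) fun x hx => ?_
    rcases lt_or_ge x 0 with h | h
    · have : ψ =ᶠ[nhds x] fun _ => 0 := by
        filter_upwards [Iio_mem_nhds h] with y hy
        exact Real.smoothTransition.zero_of_nonpos (le_of_lt hy)
      rw [this.deriv_eq, deriv_const]
    · have h1 : 1 < x := by
        by_contra hc
        exact hx ⟨h, not_lt.1 hc⟩
      have : ψ =ᶠ[nhds x] fun _ => 1 := by
        filter_upwards [Ioi_mem_nhds h1] with y hy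
        exact Real.smoothTransition.one_of_one_le (le_of_lt hy)
      rw [this.deriv_eq, deriv_const]
  obtain ⟨C₁, hC₁⟩ := hsupp.exists_bound_of_continuous hψ₁.continuous
  obtain ⟨C₂, hC₂⟩ := hsupp.deriv.exists_bound_of_continuous hψ₂.continuous
  simp only [Real.norm_eq_abs] at hC₁ hC₂
  have hC₁0 : 0 ≤ C₁ := (abs_nonneg _).trans (hC₁ 0)
  have hC₂0 : 0 ≤ C₂ := (abs_nonneg _).trans (hC₂ 0)
  obtain ⟨ε, hε, hε1, hεC⟩ : ∃ ε : ℝ, 0 < ε ∧ ε ≤ 1 ∧ ε * (C₁ + C₂) ≤ δ := by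
    refine ⟨min 1 (δ / (C₁ + C₂ + 1)), by positivity, min_le_left _ _, ?_⟩
    calc min 1 (δ / (C₁ + C₂ + 1)) * (C₁ + C₂)
        ≤ δ / (C₁ + C₂ + 1) * (C₁ + C₂ + 1) :=
          mul_le_mul (min_le_right _ _) (by linarith) (by positivity) (by positivity)
      _ = δ := by field_simp
  set g : ℝ → ℝ := fun s => ψ (1 - ε * Real.log s) with hgdef
  have hone (s : ℝ) (hs : |s| ≤ 1) : g s = 1 := by
    refine Real.smoothTransition.one_of_one_le ?_
    have : Real.log s ≤ 0 := by
      rw [← Real.log_abs]; exact Real.log_nonpos (abs_nonneg s) hs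
    nlinarith
  have hg0 : g =ᶠ[nhds 0] fun _ => 1 := by
    filter_upwards [Metric.closedBall_mem_nhds (0 : ℝ) one_pos] with s hs
    exact hone s (by simpa using hs)
  have hd (s : ℝ) (hs : s ≠ 0) :
      HasDerivAt g (deriv ψ (1 - ε * Real.log s) * -(ε * s⁻¹)) s :=
    (hψs.differentiable (by simp) _).hasDerivAt.comp s
      (((Real.hasDerivAt_log hs).const_mul ε).const_sub 1)
  have hdd (s : ℝ) (hs : s ≠ 0) : deriv (deriv g) s =
      deriv (deriv ψ) (1 - ε * Real.log s) * -(ε * s⁻¹) * -(ε * s⁻¹) +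
        deriv ψ (1 - ε * Real.log s) * -(ε * -(s ^ 2)⁻¹) := by
    have hev : deriv g =ᶠ[nhds s] fun t => deriv ψ (1 - ε * Real.log t) * -(ε * t⁻¹) := by
      filter_upwards [isOpen_ne.mem_nhds hs] with t ht using (hd t ht).deriv
    rw [hev.deriv_eq]
    have h1 : HasDerivAt (fun t => deriv ψ (1 - ε * Real.log t)) _ s :=
      (hψ₁.differentiable (by simp) _).hasDerivAt.comp s
        (((Real.hasDerivAt_log hs).const_mul ε).const_sub 1)
    exact (h1.mul ((hasDerivAt_inv hs).const_mul ε).neg).deriv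
  refine ⟨g, Real.exp (1 / ε), Real.exp_pos _, ?_, fun s => Real.smoothTransition.nonneg _,
    fun s => Real.smoothTransition.le_one _, hone, ?_, ?_, ?_⟩
  · refine contDiff_iff_contDiffAt.2 fun s => ?_
    rcases eq_or_ne s 0 with rfl | hs
    · exact contDiffAt_const.congr_of_eventuallyEq hg0
    · exact hψs.contDiffAt.comp s
        (contDiffAt_const.sub (contDiffAt_const.mul (Real.contDiffAt_log.2 hs)))
  · intro s hs
    refine Real.smoothTransition.zero_of_nonpos ?_
    have h : 1 / ε ≤ Real.log s :=
      (Real.le_log_iff_exp_le ((Real.exp_pos _).trans_le hs)).2 hs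
    rw [div_le_iff₀ hε] at h
    linarith
  · intro s
    rcases eq_or_ne s 0 with rfl | hs
    · simpa using hδ.le
    · have h : s * deriv g s = -(ε * deriv ψ (1 - ε * Real.log s)) := by
        rw [(hd s hs).deriv]
        field_simp
      rw [h, abs_neg, abs_mul, abs_of_pos hε]
      nlinarith [hC₁ (1 - ε * Real.log s)]
  · intro s
    rcases eq_or_ne s 0 with rfl | hs
    · simpa using hδ.le
    · have h : s ^ 2 * deriv (deriv g) s = ε * (ε * deriv (deriv ψ) (1 - ε * Real.log s) +
          deriv ψ (1 - ε * Real.log s)) := by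
        rw [hdd s hs]
        field_simp
      rw [h, abs_mul, abs_of_pos hε]
      refine le_trans ?_ hεC
      gcongr
      refine (abs_add_le _ _).trans ?_
      rw [abs_mul, abs_of_pos hε]
      nlinarith [hC₁ (1 - ε * Real.log s), hC₂ (1 - ε * Real.log s),
        abs_nonneg (deriv (deriv ψ) (1 - ε * Real.log s))]

lemma weightedNormSq_one_nonneg {n : ℕ} (z : Fin n → ℂ) : 0 ≤ weightedNormSq 1 z :=
  Finset.sum_nonneg fun i _ => by simpa using Complex.normSq_nonneg (z i)

lemma norm_apply_sq_le_weightedNormSq_one {n : ℕ} (z : Fin n → ℂ) (i : Fin n) :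
    ‖z i‖ ^ 2 ≤ weightedNormSq 1 z := by
  simpa [weightedNormSq, Complex.normSq_eq_norm_sq] using
    Finset.single_le_sum (f := fun i => ‖z i‖ ^ 2) (fun i _ => by positivity) (Finset.mem_univ i)

lemma norm_sq_le_weightedNormSq_one {n : ℕ} (z : Fin n → ℂ) :
    ‖z‖ ^ 2 ≤ weightedNormSq 1 z := by
  rw [← Real.le_sqrt (norm_nonneg z) (weightedNormSq_one_nonneg z),
    pi_norm_le_iff_of_nonneg (Real.sqrt_nonneg _)]
  exact fun i => Real.le_sqrt_of_sq_le (norm_apply_sq_le_weightedNormSq_one z i)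

lemma weightedNormSq_one_le {n : ℕ} (z : Fin n → ℂ) : weightedNormSq 1 z ≤ n * ‖z‖ ^ 2 := by
  have h (i : Fin n) : Complex.normSq (z i) ≤ ‖z‖ ^ 2 := by
    rw [Complex.normSq_eq_norm_sq]
    gcongr
    exact norm_le_pi_norm z i
  simpa [weightedNormSq] using Finset.sum_le_sum fun i (_ : i ∈ Finset.univ) => h i

lemma norm_mul_norm_le_weightedNormSq_one {n : ℕ} (z : Fin n → ℂ) (j k : Fin n) :
    ‖z j‖ * ‖z k‖ ≤ weightedNormSq 1 z := by
  nlinarith [two_mul_le_add_sq ‖z j‖ ‖z k‖, norm_apply_sq_le_weightedNormSq_one z j,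
    norm_apply_sq_le_weightedNormSq_one z k]

lemma abs_weightedNormSq_le {n : ℕ} {c : Fin n → ℝ} {L : ℝ} (hc : ∀ i, |c i| ≤ L)
    (z : Fin n → ℂ) : |weightedNormSq c z| ≤ L * weightedNormSq 1 z := by
  simp only [weightedNormSq, Finset.mul_sum, Pi.one_apply, one_mul]
  refine (Finset.abs_sum_le_sum_abs _ _).trans (Finset.sum_le_sum fun i _ => ?_)
  rw [abs_mul, abs_of_nonneg (Complex.normSq_nonneg _)]
  exact mul_le_mul_of_nonneg_right (hc i) (Complex.normSq_nonneg _)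

/-- A positive diagonal matrix plus a small Hermitian perturbation is positive definite. -/
lemma Matrix.posDef_diagonal_add {ι : Type*} [Fintype ι] [DecidableEq ι] {a : ι → ℝ}
    {E : Matrix ι ι ℂ} {b η : ℝ} (hE : E.IsHermitian) (ha : ∀ i, b ≤ a i)
    (hEη : ∀ i j, ‖E i j‖ ≤ η) (hb : Fintype.card ι * η < b) :
    (Matrix.diagonal (fun i => (a i : ℂ)) + E).PosDef := by
  have hA : (Matrix.diagonal (fun i => (a i : ℂ)) + E).IsHermitian :=
    (Matrix.isHermitian_diagonal_of_self_adjoint _ (by ext i; simp)).add hE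
  rw [hA.posDef_iff_eigenvalues_pos]
  intro i
  have hev : Module.End.HasEigenvalue
      (Matrix.toLin' (Matrix.diagonal (fun i => (a i : ℂ)) + E)) (hA.eigenvalues i : ℂ) := by
    rw [Module.End.hasEigenvalue_iff_mem_spectrum, Matrix.spectrum_toLin']
    exact (spectrum.algebraMap_mem_iff ℂ).2 (hA.eigenvalues_mem_spectrum_real i)
  obtain ⟨k, hk⟩ := eigenvalue_mem_ball hev
  have hoff : ∑ j ∈ Finset.univ.erase k, ‖(Matrix.diagonal (fun i => (a i : ℂ)) + E) k j‖ =
      ∑ j ∈ Finset.univ.erase k, ‖E k j‖ :=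
    Finset.sum_congr rfl fun j hj => by
      simp [Matrix.diagonal_apply_ne' _ (Finset.ne_of_mem_erase hj)]
  have hrow : ∑ j, ‖E k j‖ ≤ Fintype.card ι * η := by
    simpa using Finset.sum_le_sum fun j (_ : j ∈ Finset.univ) => hEη k j
  rw [Metric.mem_closedBall, hoff, dist_eq_norm, Matrix.add_apply, Matrix.diagonal_apply_eq] at hk
  rw [← Finset.add_sum_erase _ _ (Finset.mem_univ k)] at hrow
  have hdist : ‖((hA.eigenvalues i - a k : ℝ) : ℂ)‖ ≤
      ‖(hA.eigenvalues i : ℂ) - (a k + E k k)‖ + ‖E k k‖ := by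
    refine le_trans (le_of_eq ?_) (norm_add_le _ _)
    push_cast
    ring_nf
  rw [Complex.norm_real, Real.norm_eq_abs] at hdist
  linarith [neg_abs_le (hA.eigenvalues i - a k), ha k]

/-- given flat Kähler forms `ω₁ = Σ dzⁱ∧dz̄ⁱ` and `ω₂ = Σ λᵢ dzⁱ∧dz̄ⁱ`
with `λᵢ > 0`, there is a Kähler form `ω` (given by a smooth potential `φ` with
everywhere positive definite complex Hessian) and radii `0 < R₁ < R₂` with `ω = ω₂`
on `{‖z‖ ≤ R₁}`, `ω = ω₁` on `{‖z‖ ≥ R₂}`, and `ω = ω₁ + ∂∂̄R` with `R` compactly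
supported (i.e. `φ − Σ|zᵢ|²` has compact support). -/
theorem stmt_10 (n : ℕ) (lam : Fin n → ℝ) (hlam : ∀ i, 0 < lam i) :
    ∃ (φ : (Fin n → ℂ) → ℝ) (R₁ R₂ : ℝ), 0 < R₁ ∧ R₁ < R₂ ∧ ContDiff ℝ (⊤ : ℕ∞) φ ∧
      (∀ z : Fin n → ℂ, ‖z‖ ≤ R₁ →
        cHess n φ z = Matrix.diagonal fun j => ((lam j : ℝ) : ℂ)) ∧
      (∀ z : Fin n → ℂ, R₂ ≤ ‖z‖ → cHess n φ z = 1) ∧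
      (∀ z : Fin n → ℂ, (cHess n φ z).PosDef) ∧
      HasCompactSupport fun z : Fin n → ℂ => φ z - ∑ i, Complex.normSq (z i) := by
  set c : Fin n → ℝ := fun i => lam i - 1 with hc
  obtain ⟨m, hm0, hm1, hml⟩ : ∃ m : ℝ, 0 < m ∧ m < 1 ∧ ∀ i, m < lam i := by
    have h : ∀ᶠ m in nhdsWithin (0 : ℝ) (Set.Ioi 0), m < 1 ∧ ∀ i, m < lam i :=
      nhdsWithin_le_nhds ((gt_mem_nhds one_pos).and
        (Filter.eventually_all.2 fun i => gt_mem_nhds (hlam i)))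
    obtain ⟨m, ⟨h1, h2⟩, h0⟩ := (h.and self_mem_nhdsWithin).exists
    exact ⟨m, h0, h1, h2⟩
  set L : ℝ := ∑ i, |c i|
  have hL0 : 0 ≤ L := Finset.sum_nonneg fun i _ => abs_nonneg _
  have hcL (i : Fin n) : |c i| ≤ L :=
    Finset.single_le_sum (f := fun i => |c i|) (fun i _ => abs_nonneg _) (Finset.mem_univ i)
  obtain ⟨δ, hδ, hδm⟩ : ∃ δ : ℝ, 0 < δ ∧ n * (3 * L * δ) < m - L * δ := by
    refine ⟨m / (L * (1 + 3 * n) + 1), by positivity, ?_⟩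
    have h : m / (L * (1 + 3 * n) + 1) * (L * (1 + 3 * n) + 1) = m := by field_simp
    have h0 : 0 < m / (L * (1 + 3 * n) + 1) := by positivity
    nlinarith
  obtain ⟨g, T, hT, hg, hg0, hg1, hgone, hgzero, hgd, hgdd⟩ := exists_slow_cutoff hδ
  have hsum (z : Fin n → ℂ) : weightedNormSq 1 z = ∑ i, Complex.normSq (z i) := by
    simp [weightedNormSq]
  have hlarge (z : Fin n → ℂ) (hz : T + 1 ≤ ‖z‖) : T < weightedNormSq 1 z := by
    nlinarith [norm_sq_le_weightedNormSq_one z]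
  refine ⟨fun z => weightedNormSq 1 z + g (weightedNormSq 1 z) * weightedNormSq c z,
    1 / (n + 1), T + 1, by positivity, ?_, ?_, ?_, ?_, ?_, ?_⟩
  · have : (1 : ℝ) / (n + 1) ≤ 1 := by
      rw [div_le_one (by positivity)]
      linarith [(Nat.cast_nonneg n : (0 : ℝ) ≤ n)]
    linarith
  · exact (contDiff_weightedNormSq 1).add
      ((hg.comp (contDiff_weightedNormSq 1)).mul (contDiff_weightedNormSq c))
  · intro z hz
    have hs : weightedNormSq 1 z < 1 := by
      have hn : (0 : ℝ) ≤ n := Nat.cast_nonneg n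
      calc weightedNormSq 1 z ≤ n * ‖z‖ ^ 2 := weightedNormSq_one_le z
        _ ≤ n * (1 / (n + 1)) ^ 2 := by gcongr
        _ < 1 := by
          rw [div_pow, one_pow, mul_one_div, div_lt_one (by positivity)]
          nlinarith
    have hev : g =ᶠ[nhds (weightedNormSq 1 z)] fun _ => 1 := by
      filter_upwards [Ioo_mem_nhds
        (neg_one_lt_zero.trans_le (weightedNormSq_one_nonneg z)) hs] with t ht
      exact hgone t (abs_le.2 ⟨ht.1.le, ht.2.le⟩)
    ext j k
    rw [cHess_weightedNormSq_cutoff c hg, hev.deriv.deriv_eq, hev.deriv_eq, hev.eq_of_nhds]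
    rcases eq_or_ne j k with rfl | hjk
    · simp [hc]
    · simp [hjk]
  · intro z hz
    have hev : g =ᶠ[nhds (weightedNormSq 1 z)] fun _ => 0 := by
      filter_upwards [Ioi_mem_nhds (hlarge z hz)] with t ht using hgzero t (le_of_lt ht)
    ext j k
    rw [cHess_weightedNormSq_cutoff c hg, hev.deriv.deriv_eq, hev.deriv_eq, hev.eq_of_nhds]
    simp [Matrix.one_apply]
  · intro z
    set s := weightedNormSq 1 z with hs
    have hs0 : 0 ≤ s := weightedNormSq_one_nonneg z
    have hq : |weightedNormSq c z| ≤ L * s := abs_weightedNormSq_le hcL z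
    have hsg₁ : s * |deriv g s| ≤ δ := by
      simpa [abs_mul, abs_of_nonneg hs0] using hgd s
    have hsg₂ : s ^ 2 * |deriv (deriv g) s| ≤ δ := by
      simpa [abs_mul, abs_of_nonneg hs0] using hgdd s
    have hgq : |deriv g s * weightedNormSq c z| ≤ L * δ := by
      rw [abs_mul]
      calc |deriv g s| * |weightedNormSq c z| ≤ |deriv g s| * (L * s) := by gcongr
        _ = L * (s * |deriv g s|) := by ring
        _ ≤ L * δ := by gcongr
    set E : Matrix (Fin n) (Fin n) ℂ := Matrix.of fun j k =>
      z k * (starRingEnd ℂ (z j) * ((deriv (deriv g) s * weightedNormSq c z +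
        deriv g s * (c j + c k) : ℝ) : ℂ)) with hE
    have hsplit : cHess n (fun w => weightedNormSq 1 w + g (weightedNormSq 1 w) *
        weightedNormSq c w) z = Matrix.diagonal (fun k => ((1 + deriv g s * weightedNormSq c z +
          g s * c k : ℝ) : ℂ)) + E := by
      ext j k
      rw [cHess_weightedNormSq_cutoff c hg, Matrix.add_apply, Matrix.diagonal_apply]
      rcases eq_or_ne j k with rfl | hjk
      · simp [hE, hs]
      · simp [hE, hs, hjk]
    rw [hsplit]
    refine Matrix.posDef_diagonal_add (b := m - L * δ) (η := 3 * L * δ) ?_ ?_ ?_ ?_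
    · ext j k
      simp only [hE, Matrix.conjTranspose_apply, Matrix.of_apply, RCLike.star_def, map_mul,
        Complex.conj_conj, Complex.conj_ofReal]
      rw [add_comm (c k)]
      ring
    · intro k
      have h1 := (abs_le.1 hgq).1
      have h2 : m ≤ 1 + g s * c k := by
        have := hml k
        simp only [hc]
        nlinarith [hg0 s, hg1 s]
      linarith
    · intro j k
      have hB : |deriv (deriv g) s * weightedNormSq c z + deriv g s * (c j + c k)| ≤
          |deriv (deriv g) s| * (L * s) + |deriv g s| * (L + L) := by
        refine (abs_add_le _ _).trans ?_
        rw [abs_mul, abs_mul]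
        gcongr
        exact (abs_add_le _ _).trans (add_le_add (hcL j) (hcL k))
      have hnorm : ‖E j k‖ = ‖z k‖ * ‖z j‖ *
          |deriv (deriv g) s * weightedNormSq c z + deriv g s * (c j + c k)| := by
        simp only [hE, Matrix.of_apply, norm_mul, RCLike.norm_conj, Complex.norm_real,
          Real.norm_eq_abs, mul_assoc]
      rw [hnorm]
      calc _ ≤ s * (|deriv (deriv g) s| * (L * s) + |deriv g s| * (L + L)) :=
            mul_le_mul (norm_mul_norm_le_weightedNormSq_one z k j) hB (abs_nonneg _) hs0
        _ = L * (s ^ 2 * |deriv (deriv g) s|) + 2 * L * (s * |deriv g s|) := by ring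
        _ ≤ L * δ + 2 * L * δ := by gcongr
        _ = 3 * L * δ := by ring
    · simpa using hδm
  · refine HasCompactSupport.intro (isCompact_closedBall (0 : Fin n → ℂ) (T + 1)) fun z hz => ?_
    rw [mem_closedBall_zero_iff, not_le] at hz
    simp [← hsum, hgzero _ (hlarge z hz.le).le]
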